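/- Let W be a real Banach space such that for every metric space M with exactly five points, every subset N ⊆ M with exactly four points, every K ≥ 0 and every K-Lipschitz map f : N → W, there exists a K-Lipschitz map F : M → W extending f. Then any four closed balls B(x₁,r₁), B(x₂,r₂), B(x₃,r₃), B(x₄,r₄) in W such that B(xᵢ,rᵢ) ∩ B(xⱼ,rⱼ) ≠ ∅ for all i ≠ j satisfy B(x₁,r₁) ∩ B(x₂,r₂) ∩ B(x₃,r₃) ∩ B(x₄,r₄) ≠ ∅. -/

import Mathlib

/-- The star metric: distinct points `a`, `b` are joined through a hub, at distance `w a + w b`. -/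
abbrev starMetricSpace {α : Type*} [DecidableEq α] (w : α → ℝ) (hw : ∀ a, 0 ≤ w a)
    (hpos : ∀ a b, a ≠ b → 0 < w a + w b) : MetricSpace α where
  dist a b := if a = b then 0 else w a + w b
  dist_self a := if_pos rfl
  dist_comm a b := by simp only [eq_comm (a := a), add_comm (w a)]
  dist_triangle a b c := by
    have ha := hw a
    have hb := hw b
    have hc := hw c
    split_ifs
    all_goals first | linarith | (subst_vars; first | contradiction | linarith)
  eq_of_dist_eq_zero {a b} h := by
    by_contra hab
    exact (hpos a b hab).ne' ((if_neg hab).symm.trans h)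

theorem stmt_10 {W : Type*} [NormedAddCommGroup W] [NormedSpace ℝ W] [CompleteSpace W]
    (hext : ∀ (M : Type) [MetricSpace M], Nat.card M = 5 →
      ∀ N : Set M, N.ncard = 4 →
        ∀ K : ℝ, 0 ≤ K → ∀ f : N → W,
          (∀ x y : N, dist (f x) (f y) ≤ K * dist x y) →
          ∃ F : M → W, (∀ x y : M, dist (F x) (F y) ≤ K * dist x y) ∧
            ∀ x (hx : x ∈ N), F x = f ⟨x, hx⟩)
    (x : Fin 4 → W) (r : Fin 4 → ℝ) (hr : ∀ i, 0 < r i)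
    (hpair : ∀ i j : Fin 4, i ≠ j →
      (Metric.closedBall (x i) (r i) ∩ Metric.closedBall (x j) (r j)).Nonempty) :
    (Metric.closedBall (x 0) (r 0) ∩ Metric.closedBall (x 1) (r 1) ∩
      Metric.closedBall (x 2) (r 2) ∩ Metric.closedBall (x 3) (r 3)).Nonempty := by
  have hdist : ∀ i j, i ≠ j → dist (x i) (x j) ≤ r i + r j := by
    intro i j hij
    obtain ⟨z, hzi, hzj⟩ := hpair i j hij
    exact (dist_triangle_left _ _ z).trans (add_le_add hzi hzj)
  let w : Option (Fin 4) → ℝ := fun o => o.elim 0 r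
  have hw : ∀ a, 0 ≤ w a := by
    rintro (_ | i)
    · exact le_rfl
    · exact (hr i).le
  have hpos : ∀ a b, a ≠ b → 0 < w a + w b := by
    rintro (_ | i) (_ | j) hab
    · exact absurd rfl hab
    · exact add_pos_of_nonneg_of_pos (hw _) (hr j)
    · exact add_pos_of_pos_of_nonneg (hr i) (hw _)
    · exact add_pos (hr i) (hr j)
  let _ : MetricSpace (Option (Fin 4)) := starMetricSpace w hw hpos
  have hd : ∀ a b : Option (Fin 4), dist a b = if a = b then 0 else w a + w b := fun _ _ => rfl
  have hcard : (Set.range (some : Fin 4 → Option (Fin 4))).ncard = 4 := by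
    rw [← Set.image_univ, Set.ncard_image_of_injective _ (Option.some_injective _),
      Set.ncard_univ, Nat.card_fin]
  obtain ⟨F, hF, hFf⟩ := hext (Option (Fin 4)) (by simp) (Set.range some) hcard 1 zero_le_one
    (fun y => y.1.elim 0 x) (by
      rintro ⟨_, i, rfl⟩ ⟨_, j, rfl⟩
      rw [one_mul, Subtype.dist_eq, hd]
      rcases eq_or_ne i j with rfl | hij
      · simp
      · rw [if_neg (fun h => hij (Option.some_injective _ h))]
        exact hdist i j hij)
  have hmem : ∀ i, F none ∈ Metric.closedBall (x i) (r i) := by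
    intro i
    have h := hF none (some i)
    rw [hFf (some i) ⟨i, rfl⟩, one_mul, hd, if_neg (Option.some_ne_none i).symm] at h
    simpa [w] using h
  exact ⟨F none, ⟨⟨hmem 0, hmem 1⟩, hmem 2⟩, hmem 3⟩
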